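/- The family of positive real numbers f(j) := (s_{j+1}/(s_j − 1)²)^(2^(j−1)), indexed by integers j ≥ 1, is multipliable: the partial products Π_{j=1}^{N} f(j) converge as N → ∞ to a positive real limit. Moreover, setting α := 2·Π_{j=1}^{∞} f(j), one has 5.52 < α < 5.53. -/

import Mathlib

/-- Sylvester's sequence: `s 0 = 2`, `s (j+1) = s j * (s j − 1) + 1`;
it begins 2, 3, 7, 43, 1807, …. -/
def sylv : ℕ → ℕ
  | 0 => 2
  | n + 1 => sylv n * (sylv n - 1) + 1

theorem one_le_sylv (n : ℕ) : 1 ≤ sylv n := by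
  cases n <;> simp [sylv]

/-- The numbers `s n - 1` satisfy the recursion `a ↦ a * (a + 1)`. -/
theorem sylv_succ_sub_one (n : ℕ) :
    (sylv (n + 1) : ℝ) - 1 = ((sylv n : ℝ) - 1) * ((sylv n : ℝ) - 1 + 1) := by
  simp only [sylv]
  push_cast [Nat.cast_sub (one_le_sylv n)]
  ring

theorem one_le_sylv_sub_one (n : ℕ) : 1 ≤ (sylv n : ℝ) - 1 := by
  induction n with
  | zero => norm_num [sylv]
  | succ n ih => rw [sylv_succ_sub_one]; nlinarith

theorem six_le_sylv_sub_one (n : ℕ) : 6 ≤ (sylv (n + 2) : ℝ) - 1 := by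
  induction n with
  | zero => norm_num [sylv]
  | succ n ih => rw [sylv_succ_sub_one]; nlinarith

theorem one_le_sylv_div (n : ℕ) : 1 ≤ (sylv (n + 1) : ℝ) / ((sylv n : ℝ) - 1) ^ 2 := by
  have h := one_le_sylv_sub_one n
  rw [one_le_div (by positivity)]
  nlinarith [sylv_succ_sub_one n]

/-- A factor, together with the squared tail correction `1 + 2 / a` of the next index, is bounded
by the tail correction of the current index. -/
theorem factor_mul_correction_sq_le {a : ℝ} (ha : 6 ≤ a) :
    (a * (a + 1) + 1) / a ^ 2 * (1 + 2 / (a * (a + 1))) ^ 2 ≤ 1 + 2 / a := by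
  have h0 : 0 < a := by linarith
  have hu : 42 ≤ a * (a + 1) := by nlinarith
  have key : (a * (a + 1) + 1) * (a * (a + 1) + 2) ^ 2 ≤
      (a * (a + 1)) ^ 2 * (a * (a + 2)) := by
    nlinarith [mul_nonneg (sub_nonneg.2 ha) (sq_nonneg (a * (a + 1))),
      mul_nonneg (sub_nonneg.2 hu) (sub_nonneg.2 hu)]
  have hl : (a * (a + 1) + 1) / a ^ 2 * (1 + 2 / (a * (a + 1))) ^ 2 =
      (a * (a + 1) + 1) * (a * (a + 1) + 2) ^ 2 / (a ^ 2 * (a * (a + 1)) ^ 2) := by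
    field_simp
  have hr : 1 + 2 / a = (a * (a + 1)) ^ 2 * (a * (a + 2)) / (a ^ 2 * (a * (a + 1)) ^ 2) := by
    field_simp
  rw [hl, hr]
  gcongr

/-- The partial products of the infinite product defining `α / 2`. -/
noncomputable def alphaPartialProd (N : ℕ) : ℝ :=
  ∏ j ∈ Finset.Icc 1 N, ((sylv (j + 1) : ℝ) / ((sylv j : ℝ) - 1) ^ 2) ^ 2 ^ (j - 1)

theorem alphaPartialProd_succ (N : ℕ) :
    alphaPartialProd (N + 1) = alphaPartialProd N *
      ((sylv (N + 2) : ℝ) / ((sylv (N + 1) : ℝ) - 1) ^ 2) ^ 2 ^ N := by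
  simp [alphaPartialProd, Finset.prod_Icc_succ_top]

theorem alphaPartialProd_pos (N : ℕ) : 0 < alphaPartialProd N :=
  Finset.prod_pos fun j _ => pow_pos (zero_lt_one.trans_le (one_le_sylv_div j)) _

theorem monotone_alphaPartialProd : Monotone alphaPartialProd :=
  monotone_nat_of_le_succ fun N => by
    rw [alphaPartialProd_succ]
    exact le_mul_of_one_le_right (alphaPartialProd_pos N).le
      (one_le_pow₀ (one_le_sylv_div (N + 1)))

theorem antitone_alphaPartialProd_mul_correction :
    Antitone fun N : ℕ => alphaPartialProd (N + 1) *
      (1 + 2 / ((sylv (N + 2) : ℝ) - 1)) ^ 2 ^ (N + 1) :=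
  antitone_nat_of_succ_le fun N => by
    have ha := six_le_sylv_sub_one N
    have hs : (sylv (N + 3) : ℝ) =
        ((sylv (N + 2) : ℝ) - 1) * ((sylv (N + 2) : ℝ) - 1 + 1) + 1 := by
      linarith [sylv_succ_sub_one (N + 2)]
    rw [alphaPartialProd_succ (N + 1), mul_assoc]
    refine mul_le_mul_of_nonneg_left ?_ (alphaPartialProd_pos _).le
    change ((sylv (N + 3) : ℝ) / _) ^ _ * (1 + 2 / ((sylv (N + 3) : ℝ) - 1)) ^ _ ≤ _
    rw [hs, add_sub_cancel_right, pow_succ' 2 (N + 1), pow_mul, ← mul_pow]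
    exact pow_le_pow_left₀ (by positivity) (factor_mul_correction_sq_le ha) _

theorem alphaPartialProd_four : alphaPartialProd 4 =
    7 / 4 * (43 / 36) ^ 2 * (1807 / 1764) ^ 4 * (3263443 / 3261636) ^ 8 := by
  norm_num [alphaPartialProd, Finset.prod_Icc_succ_top, sylv]

theorem alphaPartialProd_le (N : ℕ) : alphaPartialProd N ≤ 2.764 := by
  refine (monotone_alphaPartialProd (show N ≤ N + 3 + 1 by omega)).trans ?_
  have h := antitone_alphaPartialProd_mul_correction (show 3 ≤ N + 3 by omega)
  have ha := six_le_sylv_sub_one (N + 3)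
  have hc : 1 ≤ (1 + 2 / ((sylv (N + 3 + 2) : ℝ) - 1)) ^ 2 ^ (N + 3 + 1) :=
    one_le_pow₀ (le_add_of_nonneg_right (by positivity))
  refine ((le_mul_of_one_le_right (alphaPartialProd_pos _).le hc).trans h).trans ?_
  norm_num [alphaPartialProd_four, sylv]

/-- The infinite product defining the constant `α` of section 8 of Esser–Totaro
converges: the partial products `∏_{j=1}^{N} (s_{j+1}/(s_j − 1)²)^(2^(j−1))`
converge to a positive real limit `L`, and `α := 2L` satisfies
`5.52 < α < 5.53` (in fact `α ≐ 5.522868`). -/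
theorem alpha_product_converges :
    ∃ L : ℝ, 0 < L ∧
      Filter.Tendsto
        (fun N : ℕ => ∏ j ∈ Finset.Icc 1 N,
          ((sylv (j + 1) : ℝ) / ((sylv j : ℝ) - 1) ^ 2) ^ 2 ^ (j - 1))
        Filter.atTop (nhds L) ∧
      5.52 < 2 * L ∧ 2 * L < 5.53 := by
  have hlim := tendsto_atTop_ciSup monotone_alphaPartialProd
    ⟨2.764, Set.forall_mem_range.2 alphaPartialProd_le⟩
  have hlower := monotone_alphaPartialProd.ge_of_tendsto hlim 4
  have hupper := le_of_tendsto' hlim alphaPartialProd_le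
  have hfour : 2.76 < alphaPartialProd 4 := by norm_num [alphaPartialProd_four]
  exact ⟨_, by linarith, hlim, by linarith, by linarith⟩
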